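/- The subspace V₊⁰ of V₊ spanned over k by the set {ω_{x,x} − ω_{0,0} : x ∈ F*} ∪ {2ω_{x,y} − ω_{0,0} : x, y ∈ F, x ≠ y} is a kG-submodule of V₊, and the quotient V₊/V₊⁰ is one-dimensional with trivial G-action, i.e., V₊/V₊⁰ ≅ k_tr as kG-modules. -/

import Mathlib

noncomputable section

open scoped TensorProduct

namespace SL2X

variable (p : ℕ) [Fact p.Prime]

/-- The algebraic closure of the prime field `𝔽_p`. -/
abbrev F : Type := AlgebraicClosure (ZMod p)

/-- `G = SL₂(F)`. -/
abbrev G : Type := Matrix.SpecialLinearGroup (Fin 2) (F p)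

/-- The unipotent element `ε(x) = [[1,x],[0,1]]`. -/
def eps (x : F p) : G p :=
  ⟨!![1, x; 0, 1], by simp [Matrix.det_fin_two_of]⟩

/-- The torus element `h(t) = diag(t, t⁻¹)`. -/
def h (t : (F p)ˣ) : G p :=
  ⟨!![(t : F p), 0; 0, ((t⁻¹ : (F p)ˣ) : F p)], by simp [Matrix.det_fin_two_of]⟩

/-- The Weyl element `s = [[0,1],[-1,0]]`. -/
def sG : G p :=
  ⟨!![0, 1; -1, 0], by simp [Matrix.det_fin_two_of]⟩

/-- The Borel subgroup `B` of upper triangular matrices in `G`. -/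
def B : Subgroup (G p) where
  carrier := {g | (g : Matrix (Fin 2) (Fin 2) (F p)) 1 0 = 0}
  one_mem' := by simp [Matrix.one_apply]
  mul_mem' := by
    intro a b ha hb
    simp only [Set.mem_setOf_eq] at *
    simp [Matrix.mul_apply, Fin.sum_univ_two, ha, hb]
  inv_mem' := by
    intro a ha
    simp only [Set.mem_setOf_eq] at *
    simp [Matrix.SpecialLinearGroup.coe_inv, Matrix.adjugate_fin_two, ha]

/-- The diagonal part of an element of `B`, as a unit of `F`. -/
def Bdiag (b : B p) : (F p)ˣ where
  val := ((b : G p) : Matrix (Fin 2) (Fin 2) (F p)) 0 0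
  inv := ((b : G p) : Matrix (Fin 2) (Fin 2) (F p)) 1 1
  val_inv := by
    have hdet : ((b : G p) : Matrix (Fin 2) (Fin 2) (F p)).det = 1 := (b : G p).2
    have h10 : ((b : G p) : Matrix (Fin 2) (Fin 2) (F p)) 1 0 = 0 := b.2
    rw [Matrix.det_fin_two, h10, mul_zero, sub_zero] at hdet
    exact hdet
  inv_val := by
    have hdet : ((b : G p) : Matrix (Fin 2) (Fin 2) (F p)).det = 1 := (b : G p).2
    have h10 : ((b : G p) : Matrix (Fin 2) (Fin 2) (F p)) 1 0 = 0 := b.2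
    rw [Matrix.det_fin_two, h10, mul_zero, sub_zero] at hdet
    rw [mul_comm]; exact hdet

variable (k : Type) [Field k] [IsAlgClosed k] [CharZero k]

/-- The group algebra `kG`. -/
abbrev kG : Type := MonoidAlgebra k (G p)

/-- The canonical image of a group element in the group algebra. -/
def γ (g : G p) : kG p k := MonoidAlgebra.of k (G p) g

/-- The submodule of relations defining the induced module
`M(θ) = kG ⊗_{kB} k_θ`, where the character `θ` of `T ≅ Fˣ` is extended to `B`
by letting `U` act trivially. -/
def Nmod (θ : (F p)ˣ →* kˣ) : Submodule (kG p k) (kG p k) :=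
  Submodule.span (kG p k)
    {y | ∃ b : B p, y = γ p k (b : G p) - ((θ (Bdiag p b) : k)) • (1 : kG p k)}

/-- The induced module `M(θ) = kG ⊗_{kB} k_θ`, realized as `kG / N(θ)` where
`N(θ)` is the left submodule generated by the elements `b - θ(b)·1`, `b ∈ B`. -/
def Mmod (θ : (F p)ˣ →* kˣ) : Type := kG p k ⧸ Nmod p k θ

instance (θ : (F p)ˣ →* kˣ) : AddCommGroup (Mmod p k θ) :=
  inferInstanceAs (AddCommGroup (kG p k ⧸ Nmod p k θ))
instance (θ : (F p)ˣ →* kˣ) : Module (kG p k) (Mmod p k θ) :=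
  inferInstanceAs (Module (kG p k) (kG p k ⧸ Nmod p k θ))
instance (θ : (F p)ˣ →* kˣ) : Module k (Mmod p k θ) :=
  inferInstanceAs (Module k (kG p k ⧸ Nmod p k θ))
instance (θ : (F p)ˣ →* kˣ) : IsScalarTower k (kG p k) (Mmod p k θ) :=
  inferInstanceAs (IsScalarTower k (kG p k) (kG p k ⧸ Nmod p k θ))

/-- The canonical generator `1_θ ∈ M(θ)`. -/
def oneθ (θ : (F p)ˣ →* kˣ) : Mmod p k θ :=
  Submodule.Quotient.mk (1 : kG p k)

/-- `η = (1 - s)·1_tr ∈ M(tr)`. -/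
def eta : Mmod p k 1 :=
  Submodule.Quotient.mk ((1 : kG p k) - γ p k (sG p))

/-- The Steinberg module `St = kG·η ⊆ M(tr)`. -/
def St : Submodule (kG p k) (Mmod p k 1) :=
  Submodule.span (kG p k) {eta p k}

/-- `ε(x)·η` as an element of `St`. -/
def E (x : F p) : ↥(St p k) :=
  ⟨γ p k (eps p x) • eta p k,
    Submodule.smul_mem _ _ (Submodule.mem_span_singleton_self _)⟩

/-- The action of a group element on `St`, as a `k`-linear map. -/
def gSt (g : G p) : ↥(St p k) →ₗ[k] ↥(St p k) where
  toFun v := ⟨γ p k g • (v : Mmod p k 1), Submodule.smul_mem _ _ v.2⟩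
  map_add' := by intro a b; apply Subtype.ext; simp [smul_add]
  map_smul' := by
    intro c v; apply Subtype.ext
    simp [smul_comm (γ p k g) c]

/-- `St ⊗_k St`. -/
abbrev StT : Type := ↥(St p k) ⊗[k] ↥(St p k)

/-- The diagonal action of a group element on `St ⊗_k St`. -/
def gTT (g : G p) : StT p k →ₗ[k] StT p k :=
  TensorProduct.map (gSt p k g) (gSt p k g)

/-- `ω_{x,y} = (ε(x)η ⊗ ε(y)η + ε(y)η ⊗ ε(x)η)/2`. -/
def ω (x y : F p) : StT p k :=
  (2 : k)⁻¹ • (E p k x ⊗ₜ[k] E p k y + E p k y ⊗ₜ[k] E p k x)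

/-- `ρ_{x,y} = (ε(x)η ⊗ ε(y)η − ε(y)η ⊗ ε(x)η)/2`. -/
def ρ (x y : F p) : StT p k :=
  (2 : k)⁻¹ • (E p k x ⊗ₜ[k] E p k y - E p k y ⊗ₜ[k] E p k x)

/-- `V₊`, the span of the `ω_{x,y}`. -/
def Vplus : Submodule k (StT p k) :=
  Submodule.span k {v | ∃ x y : F p, v = ω p k x y}

/-- `V₋`, the span of the `ρ_{x,y}` for `x ≠ y`. -/
def Vminus : Submodule k (StT p k) :=
  Submodule.span k {v | ∃ x y : F p, x ≠ y ∧ v = ρ p k x y}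


/-- The subspace `V₊⁰` spanned by `{ω_{x,x} − ω_{0,0} : x ≠ 0}` and
`{2ω_{x,y} − ω_{0,0} : x ≠ y}`. -/
def Vzero : Submodule k (StT p k) :=
  Submodule.span k
    ({v | ∃ x : F p, x ≠ 0 ∧ v = ω p k x x - ω p k 0 0} ∪
      {v | ∃ x y : F p, x ≠ y ∧ v = (2 : k) • ω p k x y - ω p k 0 0})

/-- The permutation representation of `G` on `k[G/B]`. -/
def permRep : Representation k (G p) (G p ⧸ B p →₀ k) where
  toFun g := Finsupp.lmapDomain k k (g • ·)
  map_one' := by ext; simp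
  map_mul' x y := by ext; simp [mul_smul]

lemma permRep_single (g : G p) (P : G p ⧸ B p) (c : k) :
    permRep p k g (Finsupp.single P c) = Finsupp.single (g • P) c :=
  Finsupp.mapDomain_single

/-- The `k`-linear map `kG → k[G/B]` sending `g` to the coset `gB`. -/
def cosetMap : kG p k →ₗ[k] (G p ⧸ B p →₀ k) where
  toFun a := (permRep p k).asAlgebraHom a (Finsupp.single ((1 : G p) : G p ⧸ B p) 1)
  map_add' a b := by simp
  map_smul' c a := by simp

lemma cosetMap_mul (a b : kG p k) :
    cosetMap p k (a * b) = (permRep p k).asAlgebraHom a (cosetMap p k b) := by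
  simp [cosetMap]

lemma cosetMap_γ (g : G p) : cosetMap p k (γ p k g) = Finsupp.single (g : G p ⧸ B p) 1 := by
  have : cosetMap p k (γ p k g) =
      permRep p k g (Finsupp.single ((1 : G p) : G p ⧸ B p) 1) := by
    simp [cosetMap, γ]
  rw [this, permRep_single]
  simp

lemma γ_one : γ p k 1 = 1 := map_one _

lemma γ_mul (g g' : G p) : γ p k (g * g') = γ p k g * γ p k g' := map_mul _ _ _

lemma cosetMap_eq_zero {a : kG p k} (ha : a ∈ Nmod p k 1) : cosetMap p k a = 0 := by
  induction ha using Submodule.span_induction with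
  | mem x hx =>
    obtain ⟨b, rfl⟩ := hx
    have hb : ((b : G p) : G p ⧸ B p) = ((1 : G p) : G p ⧸ B p) := by
      rw [eq_comm, QuotientGroup.eq]; simp
    simp [← γ_one, cosetMap_γ, hb]
  | zero => simp
  | add x y _ _ hx hy => simp [hx, hy]
  | smul a x _ hx => rw [smul_eq_mul, cosetMap_mul, hx, map_zero]

/-- The class of an element of `kG` in `M(tr)`. -/
def toM : kG p k →ₗ[kG p k] Mmod p k 1 := (Nmod p k 1).mkQ

lemma toM_surjective : Function.Surjective (toM p k) := (Nmod p k 1).mkQ_surjective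

lemma eta_eq : eta p k = toM p k (1 - γ p k (sG p)) := rfl

/-- The `k`-linear map `M(tr) → k[G/B]` induced by `cosetMap`. -/
def φ : Mmod p k 1 →ₗ[k] (G p ⧸ B p →₀ k) where
  toFun := QuotientAddGroup.lift (Nmod p k 1).toAddSubgroup (cosetMap p k).toAddMonoidHom
    fun _ ha => cosetMap_eq_zero p k ha
  map_add' := map_add _
  map_smul' c v := by
    obtain ⟨a, rfl⟩ := toM_surjective p k v
    exact map_smul (cosetMap p k) c a

lemma φ_toM (a : kG p k) : φ p k (toM p k a) = cosetMap p k a := rfl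

lemma φ_γ_smul (g : G p) (v : Mmod p k 1) :
    φ p k (γ p k g • v) = permRep p k g (φ p k v) := by
  obtain ⟨a, rfl⟩ := toM_surjective p k v
  rw [← map_smul, φ_toM, φ_toM, smul_eq_mul, cosetMap_mul]
  simp [γ]

lemma toM_mul_of_mem (g : G p) {b : G p} (hb : b ∈ B p) :
    toM p k (γ p k (g * b)) = toM p k (γ p k g) := by
  have h1 : toM p k (γ p k b) = toM p k 1 :=
    (Submodule.Quotient.eq _).2 (Submodule.subset_span ⟨⟨b, hb⟩, by simp⟩)
  have h2 := congrArg (γ p k g • ·) h1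
  simpa only [← map_smul, smul_eq_mul, ← γ_mul, mul_one] using h2

lemma eps_mem (x : F p) : eps p x ∈ B p := by
  change (eps p x : Matrix (Fin 2) (Fin 2) (F p)) 1 0 = 0
  simp [eps]

lemma coe_E (x : F p) :
    (E p k x : Mmod p k 1) = toM p k 1 - toM p k (γ p k (eps p x * sG p)) := by
  change γ p k (eps p x) • eta p k = _
  have := toM_mul_of_mem p k 1 (eps_mem p x)
  rw [one_mul, γ_one] at this
  rw [eta_eq, ← map_smul, smul_sub, map_sub, smul_eq_mul, smul_eq_mul, mul_one, γ_mul, this]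

lemma inv_mul_mem_B_iff (a b : G p) :
    a⁻¹ * b ∈ B p ↔ (a : Matrix (Fin 2) (Fin 2) (F p)) 0 0 *
      (b : Matrix (Fin 2) (Fin 2) (F p)) 1 0 = (a : Matrix (Fin 2) (Fin 2) (F p)) 1 0 *
      (b : Matrix (Fin 2) (Fin 2) (F p)) 0 0 := by
  change ((a : Matrix (Fin 2) (Fin 2) (F p)).adjugate *
    (b : Matrix (Fin 2) (Fin 2) (F p))) 1 0 = 0 ↔ _
  rw [Matrix.mul_apply, Fin.sum_univ_two, Matrix.adjugate_fin_two]
  simp [neg_add_eq_zero, eq_comm (a := _ * (b : Matrix (Fin 2) (Fin 2) (F p)) 1 0)]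

lemma coe_eps_mul_s (x : F p) :
    ((eps p x * sG p : G p) : Matrix (Fin 2) (Fin 2) (F p)) = !![-x, 1; -1, 0] := by
  change !![1, x; 0, 1] * !![0, 1; -1, 0] = _
  simp

lemma exists_bruhat (g : G p) (hg : g ∉ B p) :
    ∃ x : F p, ∃ b ∈ B p, g = eps p x * sG p * b := by
  have hc : (g : Matrix (Fin 2) (Fin 2) (F p)) 1 0 ≠ 0 := hg
  refine ⟨(g : Matrix (Fin 2) (Fin 2) (F p)) 0 0 / (g : Matrix (Fin 2) (Fin 2) (F p)) 1 0,
    (eps p _ * sG p)⁻¹ * g, ?_, (mul_inv_cancel_left _ _).symm⟩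
  rw [inv_mul_mem_B_iff, coe_eps_mul_s]
  simp [hc]

lemma toM_γ_sub_mem (g : G p) :
    toM p k (γ p k g) - toM p k 1 ∈
      Submodule.span k (Set.range fun x => (E p k x : Mmod p k 1)) := by
  by_cases hg : g ∈ B p
  · have := toM_mul_of_mem p k 1 hg
    rw [one_mul, γ_one] at this
    simp [this]
  · obtain ⟨x, b, hb, rfl⟩ := exists_bruhat p g hg
    rw [toM_mul_of_mem p k _ hb, ← neg_sub, ← coe_E]
    exact neg_mem (Submodule.subset_span ⟨x, rfl⟩)

lemma smul_eta_mem (a : kG p k) :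
    a • eta p k ∈ Submodule.span k (Set.range fun x => (E p k x : Mmod p k 1)) := by
  induction a using MonoidAlgebra.induction_on with
  | of g =>
    have : (MonoidAlgebra.of k (G p) g) • eta p k =
        (toM p k (γ p k g) - toM p k 1) - (toM p k (γ p k (g * sG p)) - toM p k 1) := by
      change γ p k g • eta p k = _
      rw [eta_eq, ← map_smul, smul_sub, map_sub, smul_eq_mul, smul_eq_mul, mul_one, γ_mul]
      abel
    rw [this]
    exact sub_mem (toM_γ_sub_mem p k g) (toM_γ_sub_mem p k _)
  | add x y hx hy => rw [add_smul]; exact add_mem hx hy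
  | smul r x hx => rw [smul_assoc]; exact Submodule.smul_mem _ _ hx

lemma span_E : Submodule.span k (Set.range (E p k)) = ⊤ := by
  refine eq_top_iff.2 fun v _ => ?_
  obtain ⟨a, ha⟩ := Submodule.mem_span_singleton.1 v.2
  have hv := smul_eta_mem p k a
  rw [ha] at hv
  have hrange : (Set.range fun x => (E p k x : Mmod p k 1)) =
      (St p k).subtype.restrictScalars k '' Set.range (E p k) := by
    rw [← Set.range_comp]; rfl
  rw [hrange, Submodule.span_image] at hv
  obtain ⟨w, hw, hwv⟩ := hv
  rwa [← Subtype.ext hwv]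

/-- The symmetric bilinear form on `k[X]` for which `X` is orthonormal. -/
def dot (X : Type*) : (X →₀ k) →ₗ[k] (X →₀ k) →ₗ[k] k :=
  (Finsupp.lift _ k X) fun P => Finsupp.lapply P

open Classical in
lemma dot_single_single {X : Type*} (P Q : X) :
    dot k X (Finsupp.single P 1) (Finsupp.single Q 1) = if P = Q then 1 else 0 := by
  simp [dot, Finsupp.single_apply, eq_comm]

lemma dot_permRep (g : G p) (u v : G p ⧸ B p →₀ k) :
    dot k _ (permRep p k g u) (permRep p k g v) = dot k _ u v := by
  suffices (dot k (G p ⧸ B p)).compl₁₂ (permRep p k g) (permRep p k g) = dot k _ from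
    LinearMap.congr_fun₂ this u v
  ext P Q
  classical
  simp [permRep_single, dot_single_single]

/-- The linear form on `St ⊗ St` induced by the invariant bilinear form on `k[G/B]`. -/
def form : StT p k →ₗ[k] k :=
  TensorProduct.lift ((dot k (G p ⧸ B p)).compl₁₂
    (φ p k ∘ₗ (St p k).subtype.restrictScalars k)
    (φ p k ∘ₗ (St p k).subtype.restrictScalars k))

lemma form_tmul (u v : St p k) :
    form p k (u ⊗ₜ v) = dot k _ (φ p k (u : Mmod p k 1)) (φ p k (v : Mmod p k 1)) := rfl

lemma form_gTT (g : G p) (v : StT p k) : form p k (gTT p k g v) = form p k v := by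
  induction v using TensorProduct.induction_on with
  | zero => simp
  | add x y hx hy => simp [hx, hy]
  | tmul u v =>
    rw [gTT, TensorProduct.map_tmul, form_tmul, form_tmul]
    change dot k _ (φ p k (γ p k g • (u : Mmod p k 1))) (φ p k (γ p k g • (v : Mmod p k 1))) = _
    rw [φ_γ_smul, φ_γ_smul, dot_permRep]

lemma φ_E (x : F p) : φ p k (E p k x : Mmod p k 1) =
    Finsupp.single ((1 : G p) : G p ⧸ B p) 1 -
      Finsupp.single ((eps p x * sG p : G p) : G p ⧸ B p) 1 := by
  rw [coe_E, map_sub, φ_toM, φ_toM, cosetMap_γ, ← γ_one, cosetMap_γ]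

lemma coset_one_ne (x : F p) :
    ((1 : G p) : G p ⧸ B p) ≠ ((eps p x * sG p : G p) : G p ⧸ B p) := by
  rw [ne_eq, QuotientGroup.eq, inv_mul_mem_B_iff, coe_eps_mul_s]
  simp

lemma coset_eps_s_eq_iff (x y : F p) :
    ((eps p x * sG p : G p) : G p ⧸ B p) = ((eps p y * sG p : G p) : G p ⧸ B p) ↔ x = y := by
  rw [QuotientGroup.eq, inv_mul_mem_B_iff, coe_eps_mul_s, coe_eps_mul_s]
  simp

open Classical in
lemma form_E (x y : F p) :
    form p k (E p k x ⊗ₜ E p k y) = 1 + if x = y then 1 else 0 := by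
  rw [form_tmul, φ_E, φ_E]
  simp only [map_sub, LinearMap.sub_apply, dot_single_single, coset_eps_s_eq_iff,
    if_neg (coset_one_ne p _), if_neg (coset_one_ne p _).symm, if_true]
  ring

lemma form_ω_self (x : F p) : form p k (ω p k x x) = 2 := by
  simp [ω, form_E]
  norm_num

lemma form_ω_of_ne {x y : F p} (hxy : x ≠ y) : form p k (ω p k x y) = 1 := by
  simp [ω, form_E, hxy, hxy.symm]
  norm_num

lemma symm_mem_Vplus (u v : St p k) :
    (2 : k)⁻¹ • (u ⊗ₜ[k] v + v ⊗ₜ[k] u) ∈ Vplus p k := by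
  have hu : u ∈ Submodule.span k (Set.range (E p k)) := by simp [span_E]
  have hv : v ∈ Submodule.span k (Set.range (E p k)) := by simp [span_E]
  induction hu, hv using Submodule.span_induction₂ with
  | mem_mem x y hx hy =>
    obtain ⟨x, rfl⟩ := hx
    obtain ⟨y, rfl⟩ := hy
    exact Submodule.subset_span ⟨x, y, rfl⟩
  | zero_left => simp
  | zero_right => simp
  | add_left x y z _ _ _ hx hy =>
    convert add_mem hx hy using 1
    simp only [TensorProduct.add_tmul, TensorProduct.tmul_add, smul_add]
    abel
  | add_right x y z _ _ _ hx hy =>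
    convert add_mem hx hy using 1
    simp only [TensorProduct.add_tmul, TensorProduct.tmul_add, smul_add]
    abel
  | smul_left r x y _ _ hx =>
    convert Submodule.smul_mem _ r hx using 1
    rw [← TensorProduct.smul_tmul', TensorProduct.tmul_smul, ← smul_add, smul_comm]
  | smul_right r x y _ _ hx =>
    convert Submodule.smul_mem _ r hx using 1
    rw [← TensorProduct.smul_tmul', TensorProduct.tmul_smul, ← smul_add, smul_comm]

lemma gTT_mem_Vplus (g : G p) {v : StT p k} (hv : v ∈ Vplus p k) : gTT p k g v ∈ Vplus p k := by
  suffices Vplus p k ≤ (Vplus p k).comap (gTT p k g) from this hv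
  refine Submodule.span_le.2 ?_
  rintro _ ⟨x, y, rfl⟩
  change gTT p k g (ω p k x y) ∈ Vplus p k
  simpa [ω, gTT] using symm_mem_Vplus p k (gSt p k g (E p k x)) (gSt p k g (E p k y))

lemma form_eq_zero {v : StT p k} (hv : v ∈ Vzero p k) : form p k v = 0 := by
  suffices Vzero p k ≤ LinearMap.ker (form p k) from this hv
  refine Submodule.span_le.2 ?_
  rintro _ (⟨x, -, rfl⟩ | ⟨x, y, hxy, rfl⟩)
  · simp [form_ω_self]
  · simp [form_ω_self, form_ω_of_ne p k hxy]

lemma sub_mem_of_mem {N : Submodule k (StT p k)} {v w : StT p k} (hv : v ∈ N) (hw : w ∈ N) :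
    v - w ∈ N := by
  have h : v - w = v + (-1 : k) • w :=
    (sub_eq_add_neg v w).trans (congrArg (v + ·) (neg_one_smul k w).symm)
  rw [h]
  exact N.add_mem hv (N.smul_mem _ hw)

lemma Vzero_le_Vplus : Vzero p k ≤ Vplus p k := by
  have hω (x y : F p) : ω p k x y ∈ Vplus p k := Submodule.subset_span ⟨x, y, rfl⟩
  refine Submodule.span_le.2 ?_
  rintro _ (⟨x, -, rfl⟩ | ⟨x, y, -, rfl⟩)
  · exact sub_mem_of_mem p k (hω _ _) (hω _ _)
  · exact sub_mem_of_mem p k (Submodule.smul_mem _ _ (hω _ _)) (hω _ _)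

lemma exists_sub_smul_mem_Vzero {v : StT p k} (hv : v ∈ Vplus p k) :
    ∃ c : k, v - c • ω p k 0 0 ∈ Vzero p k := by
  induction hv using Submodule.span_induction with
  | mem v hv =>
    obtain ⟨x, y, rfl⟩ := hv
    by_cases hxy : x = y
    · subst hxy
      refine ⟨1, ?_⟩
      by_cases hx : x = 0
      · simp [hx]
      · rw [one_smul]
        exact Submodule.subset_span (Or.inl ⟨x, hx, rfl⟩)
    · refine ⟨(2 : k)⁻¹, ?_⟩
      have h2 : (2 : k) • ω p k x y - ω p k 0 0 ∈ Vzero p k :=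
        Submodule.subset_span (Or.inr ⟨x, y, hxy, rfl⟩)
      simpa [smul_sub, smul_smul] using Submodule.smul_mem _ (2 : k)⁻¹ h2
  | zero => exact ⟨0, by simp⟩
  | add x y _ _ hx hy =>
    obtain ⟨c, hc⟩ := hx
    obtain ⟨d, hd⟩ := hy
    refine ⟨c + d, ?_⟩
    convert add_mem hc hd using 1
    rw [add_smul]; abel
  | smul r x _ hx =>
    obtain ⟨c, hc⟩ := hx
    refine ⟨r * c, ?_⟩
    have hr := Submodule.smul_mem _ r hc
    have hsub : r • (x - c • ω p k 0 0) = r • x - r • c • ω p k 0 0 := smul_sub _ _ _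
    rwa [hsub, smul_smul] at hr

lemma mem_Vzero_iff {v : StT p k} : v ∈ Vzero p k ↔ v ∈ Vplus p k ∧ form p k v = 0 := by
  refine ⟨fun hv => ⟨Vzero_le_Vplus p k hv, form_eq_zero p k hv⟩, fun ⟨hv, h0⟩ => ?_⟩
  obtain ⟨c, hc⟩ := exists_sub_smul_mem_Vzero p k hv
  have hc0 : c = 0 := by simpa [h0, form_ω_self] using form_eq_zero p k hc
  have hv0 : v - c • ω p k 0 0 = v := by
    rw [hc0, zero_smul]
    exact sub_zero v
  rwa [hv0] at hc

/-- `V₊⁰` is a `G`-stable subspace of `V₊` and the quotient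
`V₊/V₊⁰` is one-dimensional (spanned by the nonzero image of `ω_{0,0}`) with
trivial `G`-action, i.e. `V₊/V₊⁰ ≅ k_tr`. -/
theorem stmt10 (hp2 : p ≠ 2) :
    (∀ (g : G p) (v : StT p k), v ∈ Vzero p k → gTT p k g v ∈ Vzero p k) ∧
    Vzero p k ≤ Vplus p k ∧
    (∀ (g : G p) (v : StT p k), v ∈ Vplus p k → gTT p k g v - v ∈ Vzero p k) ∧
    ω p k 0 0 ∉ Vzero p k ∧
    (∀ v ∈ Vplus p k, ∃ c : k, v - c • ω p k 0 0 ∈ Vzero p k) := by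
  refine ⟨fun g v hv => ?_, Vzero_le_Vplus p k, fun g v hv => ?_, fun h0 => ?_,
    fun v hv => exists_sub_smul_mem_Vzero p k hv⟩
  · rw [mem_Vzero_iff] at hv ⊢
    exact ⟨gTT_mem_Vplus p k g hv.1, by rw [form_gTT, hv.2]⟩
  · rw [mem_Vzero_iff]
    exact ⟨sub_mem_of_mem p k (gTT_mem_Vplus p k g hv) hv, by rw [map_sub, form_gTT, sub_self]⟩
  · simpa [form_ω_self] using form_eq_zero p k h0

end SL2X
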